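/- Let W be a primitive disk word on which the basepoint-counting function P is defined, and write P(W) = (n_z(W), n_w(W)). Then n_z(W) - n_w(W) = e_Y(W), the Y-exponent sum of W. (This is the key identity established in the proof of Proposition 6.5: the relative Alexander grading produced by the paper's algorithm coincides with the grading coming from the abelianization, which is why the algorithm's graded Euler characteristic recovers the Alexander polynomial.) -/

import Mathlib

/-- A letter of the alphabet `{X, X⁻¹, Y, Y⁻¹}`. -/
inductive L where
  | X | Xi | Y | Yi
deriving DecidableEq

/-- A word is a finite sequence of letters. -/
abbrev Word := List L

/-- Whether a letter is an `X`-letter, i.e. `X` or `X⁻¹`. -/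
def L.isX : L → Bool
  | .X => true
  | .Xi => true
  | _ => false

/-- The sign of a letter: `+1` for `X`, `-1` for `X⁻¹`, `0` for `Y`-letters. -/
def L.sgn : L → ℤ
  | .X => 1
  | .Xi => -1
  | _ => 0

/-- The formal inverse of a letter. -/
def L.inv : L → L
  | .X => .Xi
  | .Xi => .X
  | .Y => .Yi
  | .Yi => .Y

/-- `phi W` = (number of `X`'s in `W`) - (number of `X⁻¹`'s in `W`). -/
def phi (w : Word) : ℤ := (w.map L.sgn).sum

/-- The subsequence of `X`-letters `x₁, …, xₙ` of a word. -/
def xLetters (w : Word) : Word := w.filter (·.isX)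

/-- The number `n` of `X`-letters of a word. -/
def numX (w : Word) : ℕ := (xLetters w).length

/-- The `i`-th `X`-letter `xᵢ` of a word (1-indexed; junk value `Y` out of range). -/
def xLtr (w : Word) (i : ℕ) : L := (xLetters w).getD (i - 1) L.Y

/-- `phi (W₁ⁱ)`: the sign-sum of the first `i` `X`-letters of `W`. -/
def phiPrefix (w : Word) (i : ℕ) : ℤ := (((xLetters w).take i).map L.sgn).sum

/-- `W` is a disk word: it has `n ≥ 2` `X`-letters, its first letter is `x₁`,
its last letter is `xₙ`, `x₁` and `xₙ` have opposite signs, and `phi W = 0`. -/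
def IsDiskWord (w : Word) : Prop :=
  2 ≤ numX w ∧
  w.head? = (xLetters w).head? ∧
  w.getLast? = (xLetters w).getLast? ∧
  phi w = 0 ∧
  (xLtr w 1).sgn = -(xLtr w (numX w)).sgn

/-- A disk word `W = W₁ⁿ` is primitive if `phi (W₁ᵏ) ≠ 0` for all `1 < k < n`. -/
def IsPrimitive (w : Word) : Prop :=
  IsDiskWord w ∧ ∀ k, 1 < k → k < numX w → phiPrefix w k ≠ 0

/-- A disk word is upward if `x₁ = X`. -/
def Upward (w : Word) : Prop := xLtr w 1 = L.X

/-- A disk word is downward if `x₁ = X⁻¹`. -/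
def Downward (w : Word) : Prop := xLtr w 1 = L.Xi

/-- `eps W i = 1` if `xᵢ` has the same sign as `x₁`, and `0` otherwise. -/
def eps (w : Word) (i : ℕ) : ℤ := if xLtr w i = xLtr w 1 then 1 else 0

/-- The height `h(xᵢ)`: `phi (W₁ⁱ) - eps xᵢ` in the upward case and
`phi (W₁ⁱ) + eps xᵢ` in the downward case. -/
def height (w : Word) (i : ℕ) : ℤ :=
  if xLtr w 1 = L.X then phiPrefix w i - eps w i else phiPrefix w i + eps w i

/-- A word is reduced if it has no adjacent pair of mutually inverse letters. -/
def Reduced (w : Word) : Prop := w.Chain' (fun a b => b ≠ a.inv)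

/-- The (0-indexed) positions in `w` of its `X`-letters. -/
def xPos (w : Word) : List ℕ :=
  (List.range w.length).filter (fun i => (w.getD i L.Y).isX)

/-- `subword w i j` = `Wᵢʲ`, the contiguous subword of `w` from the `i`-th
to the `j`-th `X`-letter (1-indexed, inclusive). -/
def subword (w : Word) (i j : ℕ) : Word :=
  (w.take ((xPos w).getD (j - 1) 0 + 1)).drop ((xPos w).getD (i - 1) 0)

/-- `Y^m`: `m` copies of `Y` if `m ≥ 0`, `-m` copies of `Y⁻¹` if `m < 0`. -/
def Ypow (m : ℤ) : Word :=
  if 0 ≤ m then List.replicate m.toNat L.Y else List.replicate (-m).toNat L.Yi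


/-- `e_Y W` = (number of `Y`'s) - (number of `Y⁻¹`'s) in `W`. -/
def eY (w : Word) : ℤ := (w.count L.Y : ℤ) - (w.count L.Yi : ℤ)

/-- Number of occurrences of the pattern `p` as a contiguous subword of `w`. -/
def countPat (p w : Word) : ℕ :=
  ((List.range w.length).filter (fun i => decide (p <+: w.drop i))).length

/-- Number of positive elementary subwords `X Y⁻¹ X⁻¹` and `X⁻¹ Y X`. -/
def posElemCount (w : Word) : ℕ :=
  countPat [L.X, L.Yi, L.Xi] w + countPat [L.Xi, L.Y, L.X] w

/-- Number of negative elementary subwords `X Y X⁻¹` and `X⁻¹ Y⁻¹ X`. -/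
def negElemCount (w : Word) : ℕ :=
  countPat [L.X, L.Y, L.Xi] w + countPat [L.Xi, L.Yi, L.X] w

/-- A disk word is positive if it has one more positive than negative elementary subword. -/
def PositiveW (w : Word) : Prop := (posElemCount w : ℤ) - (negElemCount w : ℤ) = 1

/-- A disk word is negative if it has one more negative than positive elementary subword. -/
def NegativeW (w : Word) : Prop := (posElemCount w : ℤ) - (negElemCount w : ℤ) = -1

instance (w : Word) : Decidable (PositiveW w) := by unfold PositiveW; infer_instance
instance (w : Word) : Decidable (NegativeW w) := by unfold NegativeW; infer_instance

/-- `ι_Y`: invert all `Y`-letters. -/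
def iotaY (w : Word) : Word :=
  w.map (fun l => match l with | L.Y => L.Yi | L.Yi => L.Y | l => l)

/-- `ι_X`: invert all `X`-letters. -/
def iotaX (w : Word) : Word :=
  w.map (fun l => match l with | L.X => L.Xi | L.Xi => L.X | l => l)

/-- `ι_{XY}`: invert all letters. -/
def iotaXY (w : Word) : Word := w.map L.inv

/-- The increasing list `k₁ < … < k_{d+1}` of indices `i` with `1 < i < n` and `h(xᵢ) = 1`. -/
def heightOnes (w : Word) : List ℕ :=
  (List.range (numX w)).filter (fun i => decide (1 < i ∧ i < numX w ∧ height w i = 1))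

/-- The correction term `Q` in clause (b) of the definition of `P`, determined by
`a = e_Y (W₁²)`, `b = e_Y (W_{n-1}ⁿ)` and the first and last height-one subwords. -/
def Qval (w : Word) : ℤ × ℤ :=
  let a := eY (subword w 1 2)
  let b := eY (subword w (numX w - 1) (numX w))
  let ks := heightOnes w
  if a + b = 1 then (1, 0)
  else if a + b = -1 then (0, 1)
  else if 3 ≤ ks.length ∧ PositiveW (subword w 2 (ks.getD 1 0)) ∧
      PositiveW (subword w (ks.getD (ks.length - 2) 0) (numX w - 1)) then (1, 1)
  else (0, 0)

/-- The basepoint-counting partial function `P = (n_z, n_w)` on primitive disk words,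
encoded as a relation: `PRel w p` holds iff `P` is defined at `w` with value `p`.
Clauses: (a) the four elementary bigons; (b) upward positive words with `n > 2`;
(c) upward negative; (d) downward negative; (e) downward positive (each with `n > 2`,
two-`X`-letter words being covered exactly by (a)). -/
inductive PRel : Word → ℤ × ℤ → Prop where
  | elem1 : PRel [L.X, L.Y, L.Xi] (0, -1)
  | elem2 : PRel [L.X, L.Yi, L.Xi] (0, 1)
  | elem3 : PRel [L.Xi, L.Y, L.X] (1, 0)
  | elem4 : PRel [L.Xi, L.Yi, L.X] (-1, 0)
  | upPos (w : Word) (ps : List (ℤ × ℤ)) :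
      IsPrimitive w → Upward w → PositiveW w → 2 < numX w →
      |eY (subword w 1 2) + eY (subword w (numX w - 1) (numX w))| ≤ 1 →
      ps.length + 1 = (heightOnes w).length →
      (∀ i, i + 1 < (heightOnes w).length →
        PRel (subword w ((heightOnes w).getD i 0) ((heightOnes w).getD (i + 1) 0))
          (ps.getD i 0)) →
      PRel w (Qval w + ps.sum)
  | upNeg (w : Word) (v : ℤ × ℤ) :
      IsPrimitive w → Upward w → NegativeW w → 2 < numX w →
      PRel (iotaY w) v → PRel w (-v)
  | downNeg (w : Word) (v : ℤ × ℤ) :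
      IsPrimitive w → Downward w → NegativeW w → 2 < numX w →
      PRel (iotaX w) v → PRel w (-v.2, -v.1)
  | downPos (w : Word) (v : ℤ × ℤ) :
      IsPrimitive w → Downward w → PositiveW w → 2 < numX w →
      PRel (iotaXY w) v → PRel w (v.2, v.1)

theorem eY_append (u v : Word) : eY (u ++ v) = eY u + eY v := by
  simp only [eY, List.count_append]
  push_cast
  ring

theorem eY_iotaY (w : Word) : eY (iotaY w) = -eY w := by
  induction w with
  | nil => rfl
  | cons x w ih => cases x <;> simp_all [eY, iotaY] <;> omega

theorem eY_iotaX (w : Word) : eY (iotaX w) = eY w := by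
  induction w with
  | nil => rfl
  | cons x w ih => cases x <;> simp_all [eY, iotaX] <;> omega

theorem eY_iotaXY (w : Word) : eY (iotaXY w) = -eY w := by
  induction w with
  | nil => rfl
  | cons x w ih => cases x <;> simp_all [eY, iotaXY, L.inv] <;> omega

theorem eY_take_drop (w : Word) {p q : ℕ} (h : p ≤ q) :
    eY ((w.take q).drop p) = eY (w.take q) - eY (w.take p) := by
  have h1 := eY_append ((w.take q).take p) ((w.take q).drop p)
  rw [List.take_append_drop, List.take_take, min_eq_left h] at h1
  omega

theorem eY_take_succ_of_isX (w : Word) {p : ℕ} (h : (w.getD p L.Y).isX = true) :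
    eY (w.take (p + 1)) = eY (w.take p) := by
  by_cases hp : p < w.length
  · rw [List.take_add_one, eY_append, List.getElem?_eq_getElem hp]
    rw [List.getD_eq_getElem _ _ hp] at h
    generalize w[p] = x at h
    cases x <;> simp_all [eY, L.isX]
  · rw [List.getD_eq_default _ _ (not_lt.mp hp)] at h
    simp [L.isX] at h

theorem mem_xPos {w : Word} {p : ℕ} : p ∈ xPos w ↔ (w.getD p L.Y).isX = true := by
  simp only [xPos, List.mem_filter, List.mem_range, and_iff_right_iff_imp]
  intro h
  by_contra hp
  rw [List.getD_eq_default _ _ (not_lt.mp hp)] at h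
  simp [L.isX] at h

theorem pairwise_xPos (w : Word) : (xPos w).Pairwise (· < ·) :=
  List.pairwise_lt_range.filter _

theorem pairwise_heightOnes (w : Word) : (heightOnes w).Pairwise (· < ·) :=
  List.pairwise_lt_range.filter _

theorem length_xPos (w : Word) : (xPos w).length = numX w := by
  have h : w = (List.range w.length).map (fun i => w.getD i L.Y) := by
    apply List.ext_getElem
    · simp
    · intro i h1 h2
      simp [h1]
  have h2 : xLetters w = (xPos w).map (fun i => w.getD i L.Y) := by
    conv_lhs => rw [xLetters, h, List.filter_map]
    rfl
  rw [numX, h2, List.length_map]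

theorem getD_zero_eq_of_pairwise_lt {l : List ℕ} (hl : l.Pairwise (· < ·)) {m : ℕ}
    (hm : m ∈ l) (hmin : ∀ x ∈ l, m ≤ x) : l.getD 0 0 = m := by
  cases l with
  | nil => simp at hm
  | cons a l =>
    have := hmin a (by simp)
    rcases List.mem_cons.mp hm with h | h
    · simp [h]
    · have := List.rel_of_pairwise_cons hl h
      omega

theorem getD_length_sub_one_eq_of_pairwise_lt {l : List ℕ} (hl : l.Pairwise (· < ·)) {m : ℕ}
    (hm : m ∈ l) (hmax : ∀ x ∈ l, x ≤ m) : l.getD (l.length - 1) 0 = m := by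
  obtain ⟨i, hi, rfl⟩ := List.getElem_of_mem hm
  have hlast : l.length - 1 < l.length := by omega
  rw [List.getD_eq_getElem _ _ hlast]
  refine le_antisymm (hmax _ (List.getElem_mem _)) ?_
  rcases Nat.lt_or_ge i (l.length - 1) with h | h
  · exact (List.pairwise_iff_getElem.mp hl _ _ hi hlast h).le
  · have : i = l.length - 1 := by omega
    simp [this]

theorem getD_le_getD_of_pairwise_lt {l : List ℕ} (hl : l.Pairwise (· < ·)) {i j : ℕ}
    (hij : i ≤ j) (hj : j < l.length) : l.getD i 0 ≤ l.getD j 0 := by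
  rw [List.getD_eq_getElem _ _ hj, List.getD_eq_getElem _ _ (hij.trans_lt hj)]
  rcases hij.eq_or_lt with rfl | h
  · rfl
  · exact (List.pairwise_iff_getElem.mp hl _ _ _ hj h).le

/-- `e_Y (W₁ⁱ)` for a word `W` whose first letter is `x₁`. -/
def eYPrefix (w : Word) (i : ℕ) : ℤ := eY (w.take ((xPos w).getD (i - 1) 0 + 1))

theorem isX_getD_xPos (w : Word) {i : ℕ} (hi : i < numX w) :
    (w.getD ((xPos w).getD i 0) L.Y).isX = true := by
  rw [← length_xPos] at hi
  rw [List.getD_eq_getElem _ _ hi]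
  exact mem_xPos.mp (List.getElem_mem _)

theorem eY_subword (w : Word) {i j : ℕ} (hi : 1 ≤ i) (hij : i ≤ j) (hj : j ≤ numX w) :
    eY (subword w i j) = eYPrefix w j - eYPrefix w i := by
  have hle : (xPos w).getD (i - 1) 0 ≤ (xPos w).getD (j - 1) 0 :=
    getD_le_getD_of_pairwise_lt (pairwise_xPos w) (by omega) (by rw [length_xPos]; omega)
  rw [subword, eY_take_drop w (by omega), eYPrefix, eYPrefix,
    eY_take_succ_of_isX w (isX_getD_xPos w (by omega : i - 1 < numX w))]

theorem isX_of_mem_xLetters {w : Word} {x : L} (hx : x ∈ xLetters w) : x = L.X ∨ x = L.Xi := by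
  have := (List.mem_filter.mp hx).2
  cases x <;> simp_all [L.isX]

theorem xLtr_eq_or (w : Word) {i : ℕ} (hi : 1 ≤ i) (hin : i ≤ numX w) :
    xLtr w i = L.X ∨ xLtr w i = L.Xi := by
  have h : i - 1 < (xLetters w).length := by rw [numX] at hin; omega
  rw [xLtr, List.getD_eq_getElem _ _ h]
  exact isX_of_mem_xLetters (List.getElem_mem _)

theorem phiPrefix_succ (w : Word) {i : ℕ} (hi : i + 1 ≤ numX w) :
    phiPrefix w (i + 1) = phiPrefix w i + (xLtr w (i + 1)).sgn := by
  have h : i < (xLetters w).length := hi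
  rw [phiPrefix, phiPrefix, xLtr, Nat.add_sub_cancel, List.getD_eq_getElem _ _ h,
    List.take_add_one, List.getElem?_eq_getElem h]
  simp only [Option.toList_some, List.map_append, List.map_cons, List.map_nil, List.sum_append,
    List.sum_singleton]

theorem phiPrefix_numX (w : Word) : phiPrefix w (numX w) = phi w := by
  rw [phiPrefix, numX, List.take_length, phi, xLetters]
  induction w with
  | nil => rfl
  | cons x w ih => cases x <;> simp_all [L.isX, L.sgn]

theorem IsDiskWord.eYPrefix_one {w : Word} (h : IsDiskWord w) : eYPrefix w 1 = 0 := by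
  obtain ⟨h2, hhead, -⟩ := h
  have h0 : 0 ∈ xPos w := by
    rw [mem_xPos]
    cases w with
    | nil => simp [numX, xLetters] at h2
    | cons x w =>
      have hx : x ∈ xLetters (x :: w) := List.mem_of_mem_head? (hhead.symm.trans rfl)
      simpa using (List.mem_filter.mp hx).2
  have h1 := getD_zero_eq_of_pairwise_lt (pairwise_xPos w) h0 (by simp)
  rw [eYPrefix, show 1 - 1 = 0 from rfl, h1, eY_take_succ_of_isX w (mem_xPos.mp h0)]
  rfl

theorem IsDiskWord.eYPrefix_numX {w : Word} (h : IsDiskWord w) : eYPrefix w (numX w) = eY w := by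
  obtain ⟨h2, -, hlast, -⟩ := h
  have hw : w ≠ [] := by
    rintro rfl
    simp [numX, xLetters] at h2
  have hpos := List.length_pos_iff.mpr hw
  have hmem : w.length - 1 ∈ xPos w := by
    rw [List.getLast?_eq_some_getLast hw] at hlast
    have hx := List.mem_of_getLast? hlast.symm
    rw [mem_xPos, List.getD_eq_getElem _ _ (by omega), ← List.getLast_eq_getElem hw]
    exact (List.mem_filter.mp hx).2
  have h1 := getD_length_sub_one_eq_of_pairwise_lt (pairwise_xPos w) hmem (by
    intro x hx
    have := List.mem_range.mp (List.mem_filter.mp hx).1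
    omega)
  rw [length_xPos] at h1
  rw [eYPrefix, h1, Nat.sub_add_cancel hpos, List.take_length]

theorem mem_heightOnes {w : Word} {i : ℕ} :
    i ∈ heightOnes w ↔ 1 < i ∧ i < numX w ∧ height w i = 1 := by
  simp only [heightOnes, List.mem_filter, List.mem_range, decide_eq_true_eq]
  tauto

theorem phiPrefix_one {w : Word} (hu : Upward w) (h : 1 ≤ numX w) : phiPrefix w 1 = 1 := by
  have h1 := phiPrefix_succ w (i := 0) h
  rw [zero_add, hu] at h1
  simpa [phiPrefix, L.sgn] using h1

theorem IsPrimitive.two_mem_heightOnes {w : Word} (hw : IsPrimitive w) (hu : Upward w)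
    (h2 : 2 < numX w) : 2 ∈ heightOnes w := by
  refine mem_heightOnes.mpr ⟨by omega, h2, ?_⟩
  have hs := phiPrefix_succ w (i := 1) (by omega)
  have hne := hw.2 2 (by omega) h2
  rw [phiPrefix_one hu (by omega)] at hs
  have hu' : xLtr w 1 = L.X := hu
  rcases xLtr_eq_or w (i := 2) (by omega) (by omega) with hx | hx
  · simp [height, eps, hs, hu', hx, L.sgn]
  · simp [hs, hx, L.sgn] at hne

theorem IsPrimitive.numX_sub_one_mem_heightOnes {w : Word} (hw : IsPrimitive w) (hu : Upward w)
    (h2 : 2 < numX w) : numX w - 1 ∈ heightOnes w := by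
  refine mem_heightOnes.mpr ⟨by omega, by omega, ?_⟩
  have hu' : xLtr w 1 = L.X := hu
  obtain ⟨⟨-, -, -, hphi, hsgn⟩, hne⟩ := hw
  rw [← phiPrefix_numX] at hphi
  obtain ⟨m, hm⟩ : ∃ m, numX w = m + 3 := ⟨numX w - 3, by omega⟩
  rw [hm] at hphi hsgn hne
  have hs : phiPrefix w (m + 3) = phiPrefix w (m + 2) + (xLtr w (m + 3)).sgn :=
    phiPrefix_succ w (by omega)
  have hs' := phiPrefix_succ w (i := m + 1) (by omega)
  have hm1 : phiPrefix w (m + 1) ≠ 0 := by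
    rcases Nat.eq_zero_or_pos m with rfl | hpos
    · rw [zero_add, phiPrefix_one hu (by omega)]
      decide
    · exact hne _ (by omega) (by omega)
  rw [hu', show L.X.sgn = 1 from rfl] at hsgn
  have h1 : phiPrefix w (m + 2) = 1 := by omega
  rw [hm, show m + 3 - 1 = m + 2 from rfl]
  rcases xLtr_eq_or w (i := m + 2) (by omega) (by omega) with hx | hx
  · rw [show m + 1 + 1 = m + 2 from rfl, hx, h1] at hs'
    simp only [L.sgn] at hs'
    omega
  · simp [height, eps, h1, hu', hx]

theorem Qval_fst_sub_snd {w : Word}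
    (h : |eY (subword w 1 2) + eY (subword w (numX w - 1) (numX w))| ≤ 1) :
    (Qval w).1 - (Qval w).2 = eY (subword w 1 2) + eY (subword w (numX w - 1) (numX w)) := by
  rw [abs_le] at h
  simp only [Qval]
  split_ifs <;> simp only <;> omega

theorem fst_sum_sub_snd_sum (ps : List (ℤ × ℤ)) :
    ps.sum.1 - ps.sum.2 =
      ∑ i ∈ Finset.range ps.length, ((ps.getD i 0).1 - (ps.getD i 0).2) := by
  induction ps with
  | nil => simp
  | cons p ps ih =>
    rw [List.length_cons, Finset.sum_range_succ']
    simp only [List.getD_cons_succ, List.getD_cons_zero, ← ih, List.sum_cons, Prod.fst_add,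
      Prod.snd_add]
    ring

/-- Upward primitive words are cut at height one into a first piece, a last piece and the words
`W_{k_i}^{k_{i+1}}`, consecutive ones sharing only an `X`-letter. -/
theorem IsPrimitive.eY_eq_sum {w : Word} (hw : IsPrimitive w) (hu : Upward w) (h2 : 2 < numX w)
    {d : ℕ} (hd : d + 1 = (heightOnes w).length) :
    eY w = eY (subword w 1 2) + eY (subword w (numX w - 1) (numX w)) +
      ∑ i ∈ Finset.range d,
        eY (subword w ((heightOnes w).getD i 0) ((heightOnes w).getD (i + 1) 0)) := by
  have hfirst := getD_zero_eq_of_pairwise_lt (pairwise_heightOnes w)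
    (hw.two_mem_heightOnes hu h2) (fun x hx => (mem_heightOnes.mp hx).1)
  have hlast := getD_length_sub_one_eq_of_pairwise_lt (pairwise_heightOnes w)
    (hw.numX_sub_one_mem_heightOnes hu h2) (fun x hx => by
      have := (mem_heightOnes.mp hx).2.1
      omega)
  rw [← hd, Nat.add_sub_cancel] at hlast
  have hsum : ∑ i ∈ Finset.range d,
      eY (subword w ((heightOnes w).getD i 0) ((heightOnes w).getD (i + 1) 0)) =
      ∑ i ∈ Finset.range d, (eYPrefix w ((heightOnes w).getD (i + 1) 0) -
        eYPrefix w ((heightOnes w).getD i 0)) := by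
    refine Finset.sum_congr rfl fun i hi => ?_
    have hi' : i + 1 < (heightOnes w).length := by
      have := Finset.mem_range.mp hi
      omega
    have hmem : ∀ j < (heightOnes w).length, (heightOnes w).getD j 0 ∈ heightOnes w := by
      intro j hj
      rw [List.getD_eq_getElem _ _ hj]
      exact List.getElem_mem _
    exact eY_subword w (mem_heightOnes.mp (hmem i (by omega))).1.le
      (getD_le_getD_of_pairwise_lt (pairwise_heightOnes w) (by omega) hi')
      (mem_heightOnes.mp (hmem _ hi')).2.1.le
  rw [hsum, Finset.sum_range_sub (fun i => eYPrefix w ((heightOnes w).getD i 0)), hfirst, hlast,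
    eY_subword w le_rfl (by omega) (by omega), eY_subword w (by omega) (by omega) le_rfl,
    hw.1.eYPrefix_one, hw.1.eYPrefix_numX]
  ring

theorem PRel.fst_sub_snd {w : Word} {p : ℤ × ℤ} (h : PRel w p) : p.1 - p.2 = eY w := by
  induction h with
  | elem1 => decide
  | elem2 => decide
  | elem3 => decide
  | elem4 => decide
  | upPos w ps hw hu _ h2 hab hlen _ ih =>
    rw [hw.eY_eq_sum hu h2 hlen, ← Qval_fst_sub_snd hab, Prod.fst_add, Prod.snd_add,
      add_sub_add_comm, fst_sum_sub_snd_sum]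
    congr 1
    refine Finset.sum_congr rfl fun i hi => ih i ?_
    have := Finset.mem_range.mp hi
    omega
  | upNeg w v _ _ _ _ _ ih =>
    rw [eY_iotaY] at ih
    simp only [Prod.fst_neg, Prod.snd_neg]
    omega
  | downNeg w v _ _ _ _ _ ih =>
    rw [eY_iotaX] at ih
    simp only
    omega
  | downPos w v _ _ _ _ _ ih =>
    rw [eY_iotaXY] at ih
    simp only
    omega

/-- for a primitive disk word `W` in the domain of `P`, writing
`P(W) = (n_z, n_w)`, one has `n_z - n_w = e_Y(W)`. -/
theorem nz_sub_nw_eq_eY (w : Word) (hw : IsPrimitive w) (p : ℤ × ℤ)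
    (h : PRel w p) : p.1 - p.2 = eY w :=
  h.fst_sub_snd
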